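/- arXiv:2102.03094 — 11 statements merged into one kernel-verified Lean document; each statement's English description precedes it below -/
import Mathlib

section
/- Irregular-distance Plotkin bound: let M ∈ ℕ, M ≥ 1, and let D ∈ ℕ^{M×M} be a distance matrix. If an [M,D]-code of length r exists, then r ≥ (4/M²)·Σ_{i<j} D_{ij} when M is even, and r ≥ (4/(M²−1))·Σ_{i<j} D_{ij} when M is odd. Equivalently, N(M,D) ≥ (4/M²)·Σ_{i<j} D_{ij} for M even and N(M,D) ≥ (4/(M²−1))·Σ_{i<j} D_{ij} for M odd. -/
/-- `p` is an `[M,D]`-code of length `r` over `ℤ₂`: the Hamming distance between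
codewords `p i` and `p j` is at least `D i j` for all `i, j`. -/
def IsIrregularCode {M r : ℕ} (D : Matrix (Fin M) (Fin M) ℕ)
    (p : Fin M → (Fin r → ZMod 2)) : Prop :=
  ∀ i j, D i j ≤ hammingDist (p i) (p j)

/-- `N(M,D)`: the smallest length `r` for which an `[M,D]`-code of length `r` exists. -/
noncomputable def Ncode (M : ℕ) (D : Matrix (Fin M) (Fin M) ℕ) : ℕ :=
  sInf {r : ℕ | ∃ p : Fin M → (Fin r → ZMod 2), IsIrregularCode D p}

/-- For a binary vector of length `M`, the number of ordered pairs of distinct coordinates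
is at most `M ^ 2 / 2`, with a parity correction. -/
theorem two_mul_sum_ne_add_mod_two_le {M : ℕ} (v : Fin M → ZMod 2) :
    2 * (∑ i, ∑ j, if v i ≠ v j then (1 : ℤ) else 0) + (M : ℤ) % 2 ≤ (M : ℤ) ^ 2 := by
  set x : Fin M → ℤ := fun i => if v i = 0 then 1 else -1 with hx
  have hne : ∀ i j, 2 * (if v i ≠ v j then (1 : ℤ) else 0) = 1 - x i * x j := by
    have h : ∀ a b : ZMod 2, 2 * (if a ≠ b then (1 : ℤ) else 0) =
        1 - (if a = 0 then 1 else -1) * (if b = 0 then 1 else -1) := by decide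
    exact fun i j => h (v i) (v j)
  have hsum : 2 * (∑ i, ∑ j, if v i ≠ v j then (1 : ℤ) else 0) =
      (M : ℤ) ^ 2 - (∑ i, x i) ^ 2 := by
    rw [sq (∑ i, x i), Finset.sum_mul_sum]
    simp only [Finset.mul_sum, hne, Finset.sum_sub_distrib]
    simp [sq]
  have hpar : (∑ i, x i) % 2 = (M : ℤ) % 2 := by
    have hmod : (∑ i, x i) ≡ ∑ _i : Fin M, 1 [ZMOD 2] :=
      Int.ModEq.sum fun i _ => by
        by_cases h : v i = 0 <;> simp [hx, h, Int.ModEq]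
    simpa [Int.ModEq] using hmod
  have hsq : (M : ℤ) % 2 ≤ (∑ i, x i) ^ 2 := by
    rw [← hpar]
    generalize (∑ i, x i) = s
    rcases Int.emod_two_eq_zero_or_one s with h | h
    · rw [h]; positivity
    · rw [h]
      have : s ≠ 0 := by rintro rfl; simp at h
      have := sq_pos_of_ne_zero this
      omega
  linarith

/-- The double sum of a symmetric function with zero diagonal is twice its sum over `i < j`. -/
theorem two_mul_sum_ite_lt_eq_sum_sum {M : ℕ} (f : Fin M → Fin M → ℤ)
    (hsymm : ∀ i j, f i j = f j i) (hdiag : ∀ i, f i i = 0) :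
    2 * (∑ i, ∑ j, if i < j then f i j else 0) = ∑ i, ∑ j, f i j := by
  have hswap : (∑ i, ∑ j, if i < j then f i j else 0) =
      ∑ i, ∑ j, if j < i then f i j else 0 := by
    rw [Finset.sum_comm]
    simp only [hsymm]
  rw [two_mul]
  nth_rw 2 [hswap]
  simp only [← Finset.sum_add_distrib]
  refine Finset.sum_congr rfl fun i _ => Finset.sum_congr rfl fun j _ => ?_
  rcases lt_trichotomy i j with h | h | h
  · simp [h, h.not_gt]
  · simp [h, hdiag]
  · simp [h, h.not_gt]

theorem IsIrregularCode.four_mul_sum_add_le {M r : ℕ} {D : Matrix (Fin M) (Fin M) ℕ}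
    {p : Fin M → (Fin r → ZMod 2)} (hcode : IsIrregularCode D p) :
    4 * (∑ i, ∑ j, if i < j then (D i j : ℤ) else 0) + r * ((M : ℤ) % 2) ≤
      r * (M : ℤ) ^ 2 := by
  have hle : (∑ i, ∑ j, if i < j then (D i j : ℤ) else 0) ≤
      ∑ i, ∑ j, if i < j then (hammingDist (p i) (p j) : ℤ) else 0 := by
    gcongr with i _ j _
    split_ifs
    · exact_mod_cast hcode i j
    · rfl
  have hdouble := two_mul_sum_ite_lt_eq_sum_sum
    (fun i j => (hammingDist (p i) (p j) : ℤ))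
    (fun i j => by rw [hammingDist_comm]) (fun i => by simp)
  have hcoord : (∑ i, ∑ j, (hammingDist (p i) (p j) : ℤ)) =
      ∑ k, ∑ i, ∑ j, if p i k ≠ p j k then (1 : ℤ) else 0 := by
    simp only [hammingDist, Finset.card_filter, Nat.cast_sum, Nat.cast_ite, Nat.cast_one,
      Nat.cast_zero]
    symm
    rw [Finset.sum_comm]
    exact Finset.sum_congr rfl fun i _ => Finset.sum_comm
  have hbound := Finset.sum_le_sum fun k (_ : k ∈ (Finset.univ : Finset (Fin r))) =>
    two_mul_sum_ne_add_mod_two_le fun i => p i k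
  rw [Finset.sum_add_distrib, ← Finset.mul_sum, ← hcoord] at hbound
  simp only [Finset.sum_const, Finset.card_univ, Fintype.card_fin, nsmul_eq_mul] at hbound
  linarith

theorem IsIrregularCode.plotkin_bound {M r : ℕ} (hM : 1 ≤ M) {D : Matrix (Fin M) (Fin M) ℕ}
    {p : Fin M → (Fin r → ZMod 2)} (hcode : IsIrregularCode D p) :
    (Even M →
        (4 / (M : ℝ) ^ 2) *
          (∑ i : Fin M, ∑ j : Fin M, if i < j then (D i j : ℝ) else 0) ≤ (r : ℝ)) ∧
      (¬ Even M →
        (4 / ((M : ℝ) ^ 2 - 1)) *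
          (∑ i : Fin M, ∑ j : Fin M, if i < j then (D i j : ℝ) else 0) ≤ (r : ℝ)) := by
  have hmain := hcode.four_mul_sum_add_le
  have hM' : (1 : ℝ) ≤ M := by exact_mod_cast hM
  constructor <;> intro hpar
  · have hmod : (M : ℤ) % 2 = 0 := by exact_mod_cast Nat.even_iff.mp hpar
    rw [hmod] at hmain
    have hreal : 4 * (∑ i, ∑ j, if i < j then (D i j : ℝ) else 0) + r * 0 ≤
        r * (M : ℝ) ^ 2 := by exact_mod_cast hmain
    rw [div_mul_eq_mul_div, div_le_iff₀ (by positivity)]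
    linarith
  · have hmod : (M : ℤ) % 2 = 1 := by
      exact_mod_cast Nat.odd_iff.mp (Nat.not_even_iff_odd.mp hpar)
    rw [hmod] at hmain
    have hreal : 4 * (∑ i, ∑ j, if i < j then (D i j : ℝ) else 0) + r * 1 ≤
        r * (M : ℝ) ^ 2 := by exact_mod_cast hmain
    rw [div_mul_eq_mul_div]
    exact div_le_of_le_mul₀ (by nlinarith) (by positivity) (by linarith)

/-- Irregular-distance Plotkin bound. -/
theorem irregular_plotkin_bound (M r : ℕ) (hM : 1 ≤ M)
    (D : Matrix (Fin M) (Fin M) ℕ) (hsymm : D.IsSymm) (hdiag : ∀ i, D i i = 0)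
    (p : Fin M → (Fin r → ZMod 2)) (hcode : IsIrregularCode D p) :
    ((Even M →
        (4 / (M : ℝ) ^ 2) *
          (∑ i : Fin M, ∑ j : Fin M, if i < j then (D i j : ℝ) else 0) ≤ (r : ℝ)) ∧
      (¬ Even M →
        (4 / ((M : ℝ) ^ 2 - 1)) *
          (∑ i : Fin M, ∑ j : Fin M, if i < j then (D i j : ℝ) else 0) ≤ (r : ℝ))) ∧
    ((Even M →
        (4 / (M : ℝ) ^ 2) *
          (∑ i : Fin M, ∑ j : Fin M, if i < j then (D i j : ℝ) else 0) ≤ (Ncode M D : ℝ)) ∧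
      (¬ Even M →
        (4 / ((M : ℝ) ^ 2 - 1)) *
          (∑ i : Fin M, ∑ j : Fin M, if i < j then (D i j : ℝ) else 0) ≤ (Ncode M D : ℝ))) := by
  have hne : {r : ℕ | ∃ p : Fin M → (Fin r → ZMod 2), IsIrregularCode D p}.Nonempty :=
    ⟨r, p, hcode⟩
  obtain ⟨q, hq⟩ := Nat.sInf_mem hne
  exact ⟨hcode.plotkin_bound hM, hq.plotkin_bound hM⟩
end

section
/- Gilbert–Varshamov-type bound for irregular-distance codes: let M ∈ ℕ, let D ∈ ℕ^{M×M} be a distance matrix, let π : [M] → [M] be any permutation, and let r ∈ ℕ satisfy 2^r > max_{j ∈ [M]} Σ_{i=1}^{j−1} V(r, D_{π(i)π(j)} − 1). Then there exists an [M,D]-code of length r; in particular N(M,D) ≤ r. -/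
/-- `V(r,d) = ∑_{i=0}^{d} C(r,i)`, the size of the Hamming ball of radius `d` in `ℤ₂^r`,
with `V(r,d) = 0` for `d < 0`. -/
def Vball (r : ℕ) (d : ℤ) : ℕ :=
  if d < 0 then 0 else ∑ i ∈ Finset.range (d.toNat + 1), r.choose i

/-- The number of binary vectors at distance exactly `k` from `x` is at most `r.choose k`. -/
theorem card_hammingDist_eq_le {r : ℕ} (x : Fin r → ZMod 2) (k : ℕ) :
    (Finset.univ.filter fun y => hammingDist x y = k).card ≤ r.choose k := by
  have hcard : (Finset.powersetCard k (Finset.univ : Finset (Fin r))).card = r.choose k := by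
    simp
  rw [← hcard]
  refine Finset.card_le_card_of_injOn (fun y => Finset.univ.filter fun l => x l ≠ y l) ?_ ?_
  · intro y hy
    have hy' : hammingDist x y = k := by simpa using hy
    simpa [Finset.mem_powersetCard, hammingDist] using hy'
  · intro y _ z _ hyz
    funext l
    have hl : x l ≠ y l ↔ x l ≠ z l := by
      simpa using Finset.ext_iff.mp hyz l
    have key : ∀ a b c : ZMod 2, (a ≠ b ↔ a ≠ c) → b = c := by decide
    exact key _ _ _ hl

/-- A Hamming ball with strict radius `d` has at most `Vball r (d - 1)` elements. -/
theorem card_hammingDist_lt_le {r : ℕ} (x : Fin r → ZMod 2) (d : ℕ) :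
    (Finset.univ.filter fun y => hammingDist x y < d).card ≤ Vball r ((d : ℤ) - 1) := by
  have hV : Vball r ((d : ℤ) - 1) = ∑ k ∈ Finset.range d, r.choose k := by
    rcases d with _ | d
    · simp [Vball]
    · simp [Vball]
  rw [hV, Finset.card_eq_sum_card_fiberwise (f := hammingDist x) (t := Finset.range d)
    (by intro y hy; simpa using hy)]
  refine Finset.sum_le_sum fun k _ => le_trans (Finset.card_le_card ?_) (card_hammingDist_eq_le x k)
  intro y hy
  simp only [Finset.mem_filter] at hy ⊢
  exact ⟨hy.1.1, hy.2⟩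

/-- If Hamming balls do not fill the space, some vector lies outside all of them. -/
theorem exists_forall_le_hammingDist {ι : Type*} {r : ℕ} (s : Finset ι)
    (q : ι → Fin r → ZMod 2) (d : ι → ℕ)
    (h : ∑ i ∈ s, Vball r ((d i : ℤ) - 1) < 2 ^ r) :
    ∃ y, ∀ i ∈ s, d i ≤ hammingDist (q i) y := by
  have hlt : (s.biUnion fun i => Finset.univ.filter fun y => hammingDist (q i) y < d i).card <
      (Finset.univ : Finset (Fin r → ZMod 2)).card := by
    calc _ ≤ _ := Finset.card_biUnion_le
      _ ≤ _ := Finset.sum_le_sum fun i _ => card_hammingDist_lt_le (q i) (d i)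
      _ < 2 ^ r := h
      _ = _ := by simp [ZMod.card]
  obtain ⟨y, -, hy⟩ := Finset.exists_mem_notMem_of_card_lt_card hlt
  refine ⟨y, fun i hi => ?_⟩
  by_contra! hd
  exact hy (Finset.mem_biUnion.mpr ⟨i, hi, by simpa using hd⟩)

/-- Greedy construction of a family whose earlier members keep their distance from later ones. -/
theorem exists_greedy_family {M r : ℕ} (d : Fin M → Fin M → ℕ)
    (h : ∀ j, (∑ i, if i < j then Vball r ((d i j : ℤ) - 1) else 0) < 2 ^ r) :
    ∃ q : Fin M → Fin r → ZMod 2, ∀ i j, i < j → d i j ≤ hammingDist (q i) (q j) := by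
  suffices hn : ∀ n : ℕ, ∃ q : Fin M → Fin r → ZMod 2,
      ∀ i j : Fin M, i < j → (j : ℕ) < n → d i j ≤ hammingDist (q i) (q j) by
    obtain ⟨q, hq⟩ := hn M
    exact ⟨q, fun i j hij => hq i j hij j.isLt⟩
  intro n
  induction n with
  | zero => exact ⟨fun _ => 0, fun i j _ hj => absurd hj (Nat.not_lt_zero _)⟩
  | succ n ih =>
    obtain ⟨q, hq⟩ := ih
    by_cases hnM : n < M
    · have hj := h ⟨n, hnM⟩
      rw [← Finset.sum_filter] at hj
      obtain ⟨y, hy⟩ := exists_forall_le_hammingDist _ q _ hj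
      refine ⟨Function.update q ⟨n, hnM⟩ y, fun i j hij hjn => ?_⟩
      rcases Nat.lt_succ_iff_lt_or_eq.mp hjn with hlt | heq
      · have hjne : j ≠ ⟨n, hnM⟩ := fun e => by simp [e] at hlt
        have hine : i ≠ ⟨n, hnM⟩ := fun e => by
          have : (i : ℕ) < j := hij
          simp only [e] at this
          omega
        rw [Function.update_of_ne hine, Function.update_of_ne hjne]
        exact hq i j hij hlt
      · obtain rfl : j = ⟨n, hnM⟩ := Fin.ext heq
        rw [Function.update_of_ne hij.ne, Function.update_self]
        exact hy i (by simpa using hij)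
    · exact ⟨q, fun i j hij _ => hq i j hij (by omega)⟩

/-- Gilbert–Varshamov-type bound for irregular-distance codes. -/
theorem irregular_gilbert_varshamov (M : ℕ) (D : Matrix (Fin M) (Fin M) ℕ)
    (hsymm : D.IsSymm) (hdiag : ∀ i, D i i = 0)
    (π : Equiv.Perm (Fin M)) (r : ℕ)
    (h : ∀ j : Fin M,
      (∑ i : Fin M, if i < j then Vball r ((D (π i) (π j) : ℤ) - 1) else 0) < 2 ^ r) :
    (∃ p : Fin M → (Fin r → ZMod 2), IsIrregularCode D p) ∧ Ncode M D ≤ r := by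
  have hcode : ∃ p : Fin M → (Fin r → ZMod 2), IsIrregularCode D p := by
    obtain ⟨q, hq⟩ := exists_greedy_family (fun i j => D (π i) (π j)) h
    refine ⟨fun i => q (π.symm i), fun i j => ?_⟩
    rcases lt_trichotomy (π.symm i) (π.symm j) with hij | hij | hij
    · simpa using hq _ _ hij
    · simp [π.symm.injective hij, hdiag]
    · rw [← hsymm.apply i j, hammingDist_comm]
      simpa using hq _ _ hij
  exact ⟨hcode, Nat.sInf_le hcode⟩
end

section
/- Existence of short regular-distance codes of quadratic size: for any M,D ∈ ℕ with D ≥ 10 and M ≤ D², one has N(M,D) ≤ 2D / (1 − 2√(ln D / D)); that is, there exist M vectors in ℤ₂^r with pairwise Hamming distance at least D for some length r ≤ 2D/(1 − 2√(ln D / D)). -/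
/-- `N(M,D)` for constant (regular) distance `D`: the smallest length `r` for which
there exist `M` vectors in `ℤ₂^r` with pairwise Hamming distance at least `D`. -/
noncomputable def NcodeReg (M D : ℕ) : ℕ :=
  sInf {r : ℕ | ∃ p : Fin M → (Fin r → ZMod 2),
    ∀ i j, i ≠ j → D ≤ hammingDist (p i) (p j)}

/-- The generating function of Hamming distances to a fixed binary vector. -/
lemma sum_exp_neg_mul_hammingDist (r : ℕ) (s : ℝ) (c : Fin r → ZMod 2) :
    ∑ x : Fin r → ZMod 2, Real.exp (-s * hammingDist x c) = (1 + Real.exp (-s)) ^ r := by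
  have h (x : Fin r → ZMod 2) : Real.exp (-s * hammingDist x c) =
      ∏ i, if x i = c i then 1 else Real.exp (-s) := by
    rw [hammingDist, mul_comm, Real.exp_nat_mul, Finset.prod_ite]
    simp
  have h₂ (a : ZMod 2) : ∑ b : ZMod 2, (if b = a then 1 else Real.exp (-s)) =
      1 + Real.exp (-s) := by
    rw [← Finset.add_sum_erase _ _ (Finset.mem_univ a), if_pos rfl,
      Finset.sum_congr rfl fun b hb => if_neg (Finset.ne_of_mem_erase hb)]
    simp [ZMod.card]
  simp_rw [h]
  rw [← Fintype.piFinset_univ, ← Finset.prod_univ_sum (fun _ => Finset.univ)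
    fun i b => if b = c i then 1 else Real.exp (-s)]
  simp [h₂]

/-- Chernoff bound for the volume of a Hamming ball in `ℤ₂^r`. -/
lemma card_hammingDist_le_le_exp (r d : ℕ) (hr : 0 < r) (hd : 2 * d ≤ r) (c : Fin r → ZMod 2) :
    ((Finset.univ.filter fun x : Fin r → ZMod 2 => hammingDist x c ≤ d).card : ℝ) ≤
      2 ^ r * Real.exp (-((r - 2 * d : ℝ) ^ 2 / (2 * r))) := by
  have hr' : (0 : ℝ) < r := by exact_mod_cast hr
  have hd' : (2 * d : ℝ) ≤ r := by exact_mod_cast hd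
  obtain ⟨u, hu⟩ : ∃ u : ℝ, u = (r - 2 * d) / r := ⟨_, rfl⟩
  have hu₀ : 0 ≤ u := hu ▸ div_nonneg (by linarith) hr'.le
  have hdu : (d : ℝ) = (r - r * u) / 2 := by rw [hu]; field_simp; ring
  have hball : ((Finset.univ.filter fun x : Fin r → ZMod 2 => hammingDist x c ≤ d).card : ℝ) *
      Real.exp (-(2 * u) * d) ≤ (1 + Real.exp (-(2 * u))) ^ r := by
    rw [← sum_exp_neg_mul_hammingDist r (2 * u) c, ← nsmul_eq_mul]
    refine (Finset.card_nsmul_le_sum _ (fun x => Real.exp (-(2 * u) * hammingDist x c)) _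
      fun x hx => ?_).trans (Finset.sum_le_sum_of_subset_of_nonneg (Finset.subset_univ _)
        fun _ _ _ => (Real.exp_pos _).le)
    have hx' : (hammingDist x c : ℝ) ≤ d := by exact_mod_cast (Finset.mem_filter.1 hx).2
    apply Real.exp_le_exp.2
    nlinarith
  have hcosh : 1 + Real.exp (-(2 * u)) ≤ 2 * Real.exp (-u + u ^ 2 / 2) := by
    have h := mul_le_mul_of_nonneg_left (Real.cosh_le_exp_half_sq u) (Real.exp_pos (-u)).le
    rw [Real.cosh_eq, ← Real.exp_add] at h
    have h₁ : Real.exp (-u) * Real.exp u = 1 := by rw [← Real.exp_add]; simp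
    have h₂ : Real.exp (-u) * Real.exp (-u) = Real.exp (-(2 * u)) := by
      rw [← Real.exp_add]; ring_nf
    linarith
  have hpow := pow_le_pow_left₀ (by positivity) hcosh r
  rw [mul_pow, ← Real.exp_nat_mul] at hpow
  rw [← le_div_iff₀ (Real.exp_pos _)] at hball
  refine hball.trans ((div_le_div_of_nonneg_right hpow (Real.exp_pos _).le).trans_eq ?_)
  rw [mul_div_assoc, ← Real.exp_sub, hdu]
  congr 2
  field_simp
  ring

/-- The Gilbert bound: a greedily built binary code reaches size `M` as long as
`M - 1` balls do not cover the space. -/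
lemma exists_code_of_mul_card_ball_lt (r D : ℕ) (V : ℝ)
    (hV : ∀ c : Fin r → ZMod 2,
      ((Finset.univ.filter fun x : Fin r → ZMod 2 => hammingDist x c < D).card : ℝ) ≤ V)
    (M : ℕ) (hM : ∀ m < M, (m : ℝ) * V < 2 ^ r) :
    ∃ p : Fin M → (Fin r → ZMod 2), ∀ i j, i ≠ j → D ≤ hammingDist (p i) (p j) := by
  induction M with
  | zero => exact ⟨Fin.elim0, fun i => i.elim0⟩
  | succ m ih =>
    obtain ⟨p, hp⟩ := ih fun k hk => hM k (by omega)
    obtain ⟨x, hx⟩ : ∃ x : Fin r → ZMod 2, ∀ i, D ≤ hammingDist x (p i) := by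
      by_contra! h
      have hcover : (Finset.univ : Finset (Fin r → ZMod 2)) ⊆
          Finset.univ.biUnion fun i : Fin m =>
            Finset.univ.filter fun x => hammingDist x (p i) < D := by
        intro x _
        simpa using h x
      have hcard := (Finset.card_le_card hcover).trans Finset.card_biUnion_le
      rw [Finset.card_univ, Fintype.card_fun, ZMod.card, Fintype.card_fin] at hcard
      have hcard' : (2 ^ r : ℝ) ≤ ∑ i : Fin m,
          ((Finset.univ.filter fun x => hammingDist x (p i) < D).card : ℝ) := by
        exact_mod_cast hcard
      have hsum := hcard'.trans (Finset.sum_le_sum fun i _ => hV (p i))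
      rw [Finset.sum_const, Finset.card_univ, Fintype.card_fin, nsmul_eq_mul] at hsum
      exact absurd (hM m (by omega)) hsum.not_gt
    refine ⟨Fin.cons x p, fun i j hij => ?_⟩
    induction i using Fin.cases with
    | zero =>
      induction j using Fin.cases with
      | zero => exact absurd rfl hij
      | succ j => simpa using hx j
    | succ i =>
      induction j using Fin.cases with
      | zero => simpa [hammingDist_comm] using hx i
      | succ j => simpa using hp i j fun h => hij (h ▸ rfl)

lemma log_div_self_lt_quarter {x : ℝ} (hx : 10 ≤ x) : Real.log x / x < 1 / 4 := by
  have h := Real.log_le_sub_one_of_pos (show 0 < x / 8 by positivity)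
  rw [Real.log_div (by positivity) (by norm_num), show (8 : ℝ) = 2 ^ 3 by norm_num,
    Real.log_pow] at h
  rw [div_lt_iff₀ (by positivity)]
  have := Real.log_two_lt_d9
  norm_num at h
  linarith

/-- Existence of short regular-distance codes of quadratic size:
for `D ≥ 10` and `M ≤ D²`, `N(M,D) ≤ 2D/(1 − 2√(ln D / D))`. -/
theorem short_regular_code_exists (M D : ℕ) (hD : 10 ≤ D) (hM : M ≤ D ^ 2) :
    (NcodeReg M D : ℝ) ≤ 2 * (D : ℝ) / (1 - 2 * Real.sqrt (Real.log D / D)) ∧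
    ∃ r : ℕ, (r : ℝ) ≤ 2 * (D : ℝ) / (1 - 2 * Real.sqrt (Real.log D / D)) ∧
      ∃ p : Fin M → (Fin r → ZMod 2), ∀ i j, i ≠ j → D ≤ hammingDist (p i) (p j) := by
  suffices h : ∃ r : ℕ, (r : ℝ) ≤ 2 * (D : ℝ) / (1 - 2 * Real.sqrt (Real.log D / D)) ∧
      ∃ p : Fin M → (Fin r → ZMod 2), ∀ i j, i ≠ j → D ≤ hammingDist (p i) (p j) by
    obtain ⟨r, hr, hp⟩ := h
    exact ⟨le_trans (by exact_mod_cast Nat.sInf_le hp) hr, r, hr, hp⟩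
  have hD' : (10 : ℝ) ≤ D := by exact_mod_cast hD
  have hlog : 0 ≤ Real.log D := Real.log_nonneg (by linarith)
  set ε := Real.sqrt (Real.log D / D) with hε
  have hε₀ : 0 ≤ ε := Real.sqrt_nonneg _
  have hεsq : ε ^ 2 * D = Real.log D := by
    rw [hε, Real.sq_sqrt (by positivity)]
    field_simp
  have hε₁ : 0 < 1 - 2 * ε := by
    have : ε < 1 / 2 := by
      rw [hε, Real.sqrt_lt' (by norm_num)]
      linarith [log_div_self_lt_quarter hD']
    linarith
  set R := 2 * (D : ℝ) / (1 - 2 * ε) with hR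
  have hRε : R - 2 * D = 2 * ε * R := by
    rw [hR]
    field_simp
    ring
  have hR₀ : 0 ≤ R := by positivity
  set r := ⌊R⌋₊
  have hrR : (r : ℝ) ≤ R := Nat.floor_le hR₀
  have hRr : R < r + 1 := Nat.lt_floor_add_one R
  have hgap : 2 * ε * r ≤ r - 2 * (D - 1 : ℕ) := by
    rw [Nat.cast_sub (by omega), Nat.cast_one]
    nlinarith
  have hr₀ : (0 : ℝ) ≤ 2 * ε * r := by positivity
  have h2d : 2 * (D - 1) ≤ r := by
    have : (2 * (D - 1 : ℕ) : ℝ) ≤ r := by linarith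
    exact_mod_cast this
  have hDr : (D : ℝ) ≤ r := by exact_mod_cast (show D ≤ r by omega)
  have hr : (0 : ℝ) < r := by linarith
  have hexp : 2 * Real.log D ≤ (r - 2 * (D - 1 : ℕ) : ℝ) ^ 2 / (2 * r) := by
    rw [le_div_iff₀ (by positivity), ← hεsq]
    have h₁ := pow_le_pow_left₀ hr₀ hgap 2
    have h₂ : ε ^ 2 * r * D ≤ ε ^ 2 * r * r := by gcongr
    linarith
  refine ⟨r, hrR, exists_code_of_mul_card_ball_lt r D
    (2 ^ r * Real.exp (-(2 * Real.log D))) (fun c => ?_) M fun m hm => ?_⟩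
  · have h := card_hammingDist_le_le_exp r (D - 1) (by omega) h2d c
    simp_rw [Nat.le_sub_one_iff_lt (show 0 < D by omega)] at h
    exact h.trans (by gcongr)
  · have hmD : (m : ℝ) < (D : ℝ) ^ 2 := by exact_mod_cast hm.trans_le hM
    have hexp_eq : Real.exp (-(2 * Real.log D)) = ((D : ℝ) ^ 2)⁻¹ := by
      rw [Real.exp_neg, two_mul, Real.exp_add, Real.exp_log (by linarith), sq]
    rw [hexp_eq, mul_left_comm, ← div_eq_mul_inv]
    exact mul_lt_of_lt_one_right (by positivity) ((div_lt_one (by positivity)).2 hmD)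
end

section
/- Subset lower bound on FCC redundancy: for any function f : ℤ₂^k → S, any t ∈ ℕ, and any pairwise distinct vectors u_1, …, u_M ∈ ℤ₂^k, the optimal redundancy satisfies r_f(k,t) ≥ N(M, D_f(t, u_1, …, u_M)). -/
/-- The systematic encoding `u ↦ (u, p u)` is a function-correcting code for `f`
tolerating `t` errors. -/
def IsFCC {k r : ℕ} {S : Type*} (t : ℕ) (f : (Fin k → ZMod 2) → S)
    (p : (Fin k → ZMod 2) → (Fin r → ZMod 2)) : Prop :=
  ∀ u₁ u₂ : Fin k → ZMod 2, f u₁ ≠ f u₂ →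
    2 * t + 1 ≤ hammingDist u₁ u₂ + hammingDist (p u₁) (p u₂)

/-- `r_f(k,t)`: the optimal (smallest) redundancy of an FCC for `f` tolerating `t` errors. -/
noncomputable def FCCredundancy {k : ℕ} {S : Type*} (f : (Fin k → ZMod 2) → S)
    (t : ℕ) : ℕ :=
  sInf {r : ℕ | ∃ p : (Fin k → ZMod 2) → (Fin r → ZMod 2), IsFCC t f p}

/-- The distance requirement matrix `D_f(t, u_1, …, u_M)`. -/
def distReqMatrix {k M : ℕ} {S : Type*} [DecidableEq S] (f : (Fin k → ZMod 2) → S)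
    (t : ℕ) (u : Fin M → (Fin k → ZMod 2)) : Matrix (Fin M) (Fin M) ℕ :=
  fun i j => if f (u i) ≠ f (u j) then 2 * t + 1 - hammingDist (u i) (u j) else 0

/-- The redundancy part of an FCC restricted to `u_1, …, u_M` is an irregular code for the
distance requirement matrix. -/
theorem IsFCC.isIrregularCode {k t r M : ℕ} {S : Type*} [DecidableEq S]
    {f : (Fin k → ZMod 2) → S} {p : (Fin k → ZMod 2) → (Fin r → ZMod 2)} (hp : IsFCC t f p)
    (u : Fin M → (Fin k → ZMod 2)) : IsIrregularCode (distReqMatrix f t u) (p ∘ u) := by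
  intro i j
  unfold distReqMatrix
  split_ifs with h
  · have := hp (u i) (u j) h
    simp only [Function.comp_apply]
    omega
  · exact Nat.zero_le _

/-- Repeating every coordinate `2 * t + 1` times gives an FCC for every function. -/
theorem isFCC_repetition {k : ℕ} {S : Type*} (f : (Fin k → ZMod 2) → S) (t : ℕ) :
    IsFCC t f fun u (i : Fin (k * (2 * t + 1))) => u (finProdFinEquiv.symm i).1 := by
  intro u v h
  obtain ⟨a, ha⟩ := Function.ne_iff.mp (ne_of_apply_ne f h)
  refine le_trans ?_ (Nat.le_add_left _ _)
  calc 2 * t + 1 = (Finset.univ : Finset (Fin (2 * t + 1))).card := by simp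
    _ ≤ _ := Finset.card_le_card_of_injOn (fun j => finProdFinEquiv (a, j))
      (fun j _ => by
        simpa [-finProdFinEquiv_symm_apply] using ha)
      (fun i _ j _ hij => by simpa using hij)

/-- Subset lower bound on FCC redundancy: for pairwise distinct `u_1,…,u_M ∈ ℤ₂^k`,
`r_f(k,t) ≥ N(M, D_f(t, u_1, …, u_M))`. -/
theorem fcc_subset_lower_bound {k t M : ℕ} {S : Type*} [DecidableEq S]
    (f : (Fin k → ZMod 2) → S)
    (u : Fin M → (Fin k → ZMod 2)) (hu : Function.Injective u) :
    Ncode M (distReqMatrix f t u) ≤ FCCredundancy f t := by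
  obtain ⟨p, hp⟩ : FCCredundancy f t ∈
      {r : ℕ | ∃ p : (Fin k → ZMod 2) → (Fin r → ZMod 2), IsFCC t f p} :=
    Nat.sInf_mem ⟨_, _, isFCC_repetition f t⟩
  exact Nat.sInf_le ⟨p ∘ u, hp.isIrregularCode u⟩
end

section
/- Lower bound via close full-image representatives: let f : ℤ₂^k → S be a function with image of size E, and let e* ∈ ℕ be the smallest integer such that there exist vectors u_1, …, u_E ∈ ℤ₂^k with {f(u_1), …, f(u_E)} equal to the image of f and d(u_i, u_j) ≤ e* for all i,j. Then r_f(k,t) ≥ N(E, 2t+1−e*) (where 2t+1−e* is interpreted as max(2t+1−e*,0)). -/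
/-- There are `E` representatives `u_1,…,u_E` covering the whole image of `f`,
with all pairwise Hamming distances at most `e`. -/
def HasCloseRepresentatives {k E : ℕ} {S : Type*} (f : (Fin k → ZMod 2) → S)
    (e : ℕ) : Prop :=
  ∃ u : Fin E → (Fin k → ZMod 2),
    Set.range (fun i => f (u i)) = Set.range f ∧
    ∀ i j, hammingDist (u i) (u j) ≤ e

/-- The `n`-fold repetition encoding separates distinct words by Hamming distance at least `n`. -/
theorem le_hammingDist_repetition {α : Type*} [DecidableEq α] {k n : ℕ} {u v : Fin k → α}
    (h : u ≠ v) :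
    n ≤ hammingDist (fun x : Fin (k * n) => u (finProdFinEquiv.symm x).1)
      (fun x => v (finProdFinEquiv.symm x).1) := by
  obtain ⟨i, hi⟩ := Function.ne_iff.mp h
  have hinj : Function.Injective fun j : Fin n => finProdFinEquiv (i, j) := fun a b hab => by
    simpa using hab
  calc n = (Finset.univ.image fun j : Fin n => finProdFinEquiv (i, j)).card := by
        rw [Finset.card_image_of_injective _ hinj, Finset.card_univ, Fintype.card_fin]
    _ ≤ _ := by
        refine Finset.card_le_card fun x hx => ?_
        obtain ⟨j, -, rfl⟩ := Finset.mem_image.mp hx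
        simpa only [Finset.mem_filter, Finset.mem_univ, true_and, Equiv.symm_apply_apply] using hi

theorem exists_isFCC {k : ℕ} {S : Type*} (f : (Fin k → ZMod 2) → S) (t : ℕ) :
    ∃ r, ∃ p : (Fin k → ZMod 2) → (Fin r → ZMod 2), IsFCC t f p :=
  ⟨k * (2 * t + 1), fun u x => u (finProdFinEquiv.symm x).1, fun _ _ h =>
    (le_hammingDist_repetition (ne_of_apply_ne f h)).trans (Nat.le_add_left _ _)⟩

/-- A family indexed by `Fin (Nat.card s)` whose range is the finite set `s` is injective. -/
theorem injective_of_range_eq_of_natCard {S : Type*} {s : Set S} [Finite s] {E : ℕ}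
    (hE : E = Nat.card s) {g : Fin E → S} (hg : Set.range g = s) : Function.Injective g := by
  subst hg
  have hbij := (Nat.bijective_iff_surjective_and_card (Set.rangeFactorization g)).mpr
    ⟨Set.rangeFactorization_surjective, (Nat.card_fin E).trans hE⟩
  exact Set.rangeFactorization_injective.mp hbij.injective

/-- Lower bound via close full-image representatives: with `E = |Im(f)|` and `e*` the
smallest integer for which full-image representatives of pairwise distance `≤ e*` exist,
`r_f(k,t) ≥ N(E, 2t+1−e*)` (positive part taken via truncated subtraction). -/
theorem fcc_lower_bound_close_representatives {k t : ℕ} {S : Type*}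
    (f : (Fin k → ZMod 2) → S) (E : ℕ) (hE : E = Nat.card (Set.range f))
    (estar : ℕ)
    (hex : HasCloseRepresentatives (E := E) f estar)
    (hmin : ∀ e' < estar, ¬ HasCloseRepresentatives (E := E) f e') :
    NcodeReg E (2 * t + 1 - estar) ≤ FCCredundancy f t := by
  obtain ⟨u, hu, hd⟩ := hex
  have hinj : Function.Injective fun i => f (u i) := injective_of_range_eq_of_natCard hE hu
  obtain ⟨p, hp⟩ : FCCredundancy f t ∈
      {r : ℕ | ∃ p : (Fin k → ZMod 2) → (Fin r → ZMod 2), IsFCC t f p} :=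
    Nat.sInf_mem (exists_isFCC f t)
  refine Nat.sInf_le ⟨fun i => p (u i), fun i j hij => ?_⟩
  have h₁ := hp (u i) (u j) (hinj.ne hij)
  have h₂ := hd i j
  dsimp only
  omega
end

section
/- Universal lower bound: for any function f : ℤ₂^k → S whose image has size E ≥ 2 and any t ∈ ℕ, the optimal redundancy satisfies r_f(k,t) ≥ 2t. -/
/-- A map on a finite product that is invariant under changing a single coordinate is constant. -/
theorem eq_of_forall_update_eq {ι S : Type*} {α : ι → Type*} [Fintype ι] [DecidableEq ι]
    {f : (∀ i, α i) → S} (h : ∀ u i a, f (Function.update u i a) = f u) (u v : ∀ i, α i) :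
    f u = f v := by
  have key : ∀ s : Finset ι, f (s.piecewise u v) = f v := by
    intro s
    induction s using Finset.induction_on with
    | empty => simp
    | insert i s _ ih => rw [Finset.piecewise_insert, h, ih]
  simpa using key Finset.univ

/-- Changing one coordinate moves a word by Hamming distance at most one. -/
theorem hammingDist_update_le_one {ι : Type*} {α : ι → Type*} [Fintype ι] [DecidableEq ι]
    [∀ i, DecidableEq (α i)] (u : ∀ i, α i) (i : ι) (a : α i) :
    hammingDist (Function.update u i a) u ≤ 1 := by
  rw [hammingDist, ← Finset.card_singleton i]
  refine Finset.card_le_card fun j hj => ?_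
  by_contra hji
  simp_all

/-- Repeating every coordinate `n` times separates distinct words by distance at least `n`. -/
theorem le_hammingDist_repeat {k n : ℕ} {α : Type*} [DecidableEq α] {u v : Fin k → α}
    (h : u ≠ v) :
    n ≤ hammingDist (fun x : Fin (k * n) => u x.divNat) (fun x => v x.divNat) := by
  obtain ⟨j, hj⟩ := Function.ne_iff.mp h
  have hinj : Function.Injective fun i : Fin n => finProdFinEquiv (j, i) := fun a b hab => by
    simpa using hab
  calc n = (Finset.univ.map ⟨_, hinj⟩).card := by simp
    _ ≤ _ := Finset.card_le_card fun x hx => by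
      obtain ⟨i, -, rfl⟩ := Finset.mem_map.mp hx
      have hdiv : (finProdFinEquiv (j, i)).divNat = j :=
        congrArg Prod.fst (finProdFinEquiv.symm_apply_apply (j, i))
      simpa [hdiv] using hj

/-- The repetition code is an FCC for every function. -/
theorem isFCC_repeat {k : ℕ} {S : Type*} (t : ℕ) (f : (Fin k → ZMod 2) → S) :
    IsFCC t f fun u (x : Fin (k * (2 * t + 1))) => u x.divNat := fun _ _ h =>
  (le_hammingDist_repeat (ne_of_apply_ne f h)).trans (Nat.le_add_left _ _)

/-- An FCC for a nonconstant function has redundancy at least `2 * t`. -/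
theorem IsFCC.two_mul_le {k r t : ℕ} {S : Type*} {f : (Fin k → ZMod 2) → S}
    {p : (Fin k → ZMod 2) → (Fin r → ZMod 2)} (hp : IsFCC t f p)
    {u v : Fin k → ZMod 2} (huv : f u ≠ f v) : 2 * t ≤ r := by
  obtain ⟨w, i, a, hw⟩ : ∃ w i a, f (Function.update w i a) ≠ f w := by
    by_contra! h
    exact huv (eq_of_forall_update_eq h u v)
  have h₁ := hp _ _ hw
  have h₂ := hammingDist_update_le_one w i a
  have h₃ : hammingDist (p (Function.update w i a)) (p w) ≤ r := by
    simpa using hammingDist_le_card_fintype (x := p (Function.update w i a)) (y := p w)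
  omega

/-- Universal lower bound: if the image of `f` has at least 2 elements,
then `r_f(k,t) ≥ 2t`. -/
theorem fcc_universal_lower_bound {k t : ℕ} {S : Type*}
    (f : (Fin k → ZMod 2) → S) (hE : 2 ≤ Nat.card (Set.range f)) :
    2 * t ≤ FCCredundancy f t := by
  have : Finite (Set.range f) := Nat.finite_of_card_ne_zero (by omega)
  have : Nontrivial (Set.range f) := Finite.one_lt_card_iff_nontrivial.mp hE
  obtain ⟨⟨_, u, rfl⟩, ⟨_, v, rfl⟩, huv⟩ := exists_pair_ne (Set.range f)
  refine le_csInf ⟨_, _, isFCC_repeat t f⟩ ?_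
  rintro r ⟨p, hp⟩
  exact hp.two_mul_le fun h => huv (Subtype.ext h)
end

section
/- Achievability via function-distance codes: for any function f : ℤ₂^k → S with image {f_1, …, f_E} of size E and any t ∈ ℕ, the optimal redundancy satisfies r_f(k,t) ≤ N(E, D_f(t, f_1, …, f_E)), where D_f(t, f_1, …, f_E) is the function-distance matrix of f. -/
/-- `d_f(s₁,s₂)`: the smallest Hamming distance between information vectors evaluating
to the function values `s₁` and `s₂`. -/
noncomputable def funcDist {k : ℕ} {S : Type*} (f : (Fin k → ZMod 2) → S)
    (s₁ s₂ : S) : ℕ :=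
  sInf {n : ℕ | ∃ u₁ u₂ : Fin k → ZMod 2,
    f u₁ = s₁ ∧ f u₂ = s₂ ∧ hammingDist u₁ u₂ = n}

/-- The function-distance matrix `D_f(t, f_1, …, f_E)`, where `fv i` is the `i`-th
function value. -/
noncomputable def funcDistMatrix {k E : ℕ} {S : Type*} (f : (Fin k → ZMod 2) → S)
    (t : ℕ) (fv : Fin E → S) : Matrix (Fin E) (Fin E) ℕ :=
  fun i j => if i = j then 0 else 2 * t + 1 - funcDist f (fv i) (fv j)

/-- Irregular-distance codes of some length exist for every requirement matrix with zero
diagonal: concatenate sufficiently many copies of the standard basis vectors. -/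
theorem exists_isIrregularCode {M : ℕ} (D : Matrix (Fin M) (Fin M) ℕ)
    (hD : ∀ i, D i i = 0) :
    ∃ (r : ℕ) (p : Fin M → (Fin r → ZMod 2)), IsIrregularCode D p := by
  set B : ℕ := ∑ i, ∑ j, D i j with hB
  refine ⟨M * B, fun i x => if (finProdFinEquiv.symm x).1 = i then 1 else 0, ?_⟩
  intro i j
  by_cases hij : i = j
  · subst hij
    simp [hD]
  have hle : D i j ≤ B :=
    (Finset.single_le_sum (f := fun j => D i j) (fun _ _ => Nat.zero_le _)
      (Finset.mem_univ j)).trans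
      (Finset.single_le_sum (f := fun i => ∑ j, D i j) (fun _ _ => Nat.zero_le _)
        (Finset.mem_univ i))
  refine hle.trans ?_
  have hcard : (Finset.univ.image fun b : Fin B => finProdFinEquiv (i, b)).card = B := by
    rw [Finset.card_image_of_injective _ fun a b h => by simpa using h]
    simp
  refine hcard.ge.trans ?_
  rw [hammingDist]
  refine Finset.card_le_card fun x hx => ?_
  obtain ⟨b, -, rfl⟩ := Finset.mem_image.mp hx
  simp only [Finset.mem_filter, Finset.mem_univ, true_and, Equiv.symm_apply_apply]
  simp [hij]

theorem funcDist_le_hammingDist {k : ℕ} {S : Type*} (f : (Fin k → ZMod 2) → S)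
    (u₁ u₂ : Fin k → ZMod 2) : funcDist f (f u₁) (f u₂) ≤ hammingDist u₁ u₂ :=
  Nat.sInf_le ⟨u₁, u₂, rfl, rfl, rfl⟩

/-- A code for the function-distance matrix yields a function-correcting code by assigning
to each information vector the codeword of its function value. -/
theorem IsIrregularCode.isFCC {k t E r : ℕ} {S : Type*} {f : (Fin k → ZMod 2) → S}
    {fv : Fin E → S} {p : Fin E → (Fin r → ZMod 2)}
    (hp : IsIrregularCode (funcDistMatrix f t fv) p)
    {idx : (Fin k → ZMod 2) → Fin E} (hidx : ∀ u, fv (idx u) = f u) :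
    IsFCC t f fun u => p (idx u) := by
  intro u₁ u₂ hne
  have hidx_ne : idx u₁ ≠ idx u₂ := fun h => hne (by rw [← hidx, ← hidx, h])
  have hcode := hp (idx u₁) (idx u₂)
  rw [funcDistMatrix, if_neg hidx_ne, hidx, hidx] at hcode
  have hdist := funcDist_le_hammingDist f u₁ u₂
  dsimp only
  omega

/-- Achievability via function-distance codes: if `fv : Fin E → S` enumerates the image
of `f` without repetition, then `r_f(k,t) ≤ N(E, D_f(t, f_1, …, f_E))`. -/
theorem fcc_achievability {k t E : ℕ} {S : Type*} (f : (Fin k → ZMod 2) → S)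
    (fv : Fin E → S) (hinj : Function.Injective fv)
    (hrange : Set.range fv = Set.range f) :
    FCCredundancy f t ≤ Ncode E (funcDistMatrix f t fv) := by
  have hmem : ∀ u, ∃ i, fv i = f u := fun u => hrange.ge (Set.mem_range_self u)
  choose idx hidx using hmem
  obtain ⟨p, hp⟩ := Nat.sInf_mem
    (exists_isIrregularCode (funcDistMatrix f t fv) fun i => by simp [funcDistMatrix])
  exact Nat.sInf_le ⟨_, hp.isFCC hidx⟩
end

section
/- Upper bound via error-correcting codes on function values: for any function f : ℤ₂^k → S whose image has size E and any t ∈ ℕ, the optimal redundancy satisfies r_f(k,t) ≤ N(E, 2t); i.e., appending to u a codeword (indexed by f(u)) of any code of cardinality E and minimum Hamming distance 2t yields an FCC for f. -/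
/-- Repeating each coordinate of the standard basis `D` times gives codes of every size and
every minimum distance. -/
theorem exists_code_minDist (M D : ℕ) :
    ∃ r : ℕ, ∃ p : Fin M → (Fin r → ZMod 2),
      ∀ i j, i ≠ j → D ≤ hammingDist (p i) (p j) := by
  refine ⟨M * D, fun i x => if (finProdFinEquiv.symm x).1 = i then 1 else 0, fun i j hij => ?_⟩
  have hinj : Function.Injective fun a : Fin D => finProdFinEquiv (i, a) := fun a b h => by
    simpa using h
  calc D = (Finset.univ.image fun a : Fin D => finProdFinEquiv (i, a)).card := by
        rw [Finset.card_image_of_injective _ hinj, Finset.card_univ, Fintype.card_fin]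
    _ ≤ _ := by
        refine Finset.card_le_card fun x hx => ?_
        obtain ⟨a, -, rfl⟩ := Finset.mem_image.mp hx
        simp [-finProdFinEquiv_symm_apply, hij]

/-- The set defining `NcodeReg M D` attains its infimum. -/
theorem NcodeReg_spec (M D : ℕ) :
    ∃ p : Fin M → (Fin (NcodeReg M D) → ZMod 2),
      ∀ i j, i ≠ j → D ≤ hammingDist (p i) (p j) :=
  Nat.sInf_mem (exists_code_minDist M D)

/-- Appending to `u` a codeword indexed by `f u`, from a code of minimum distance `2 * t`, is an
FCC for `f`. -/
theorem isFCC_of_code {k r t : ℕ} {S ι : Type*} (f : (Fin k → ZMod 2) → S)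
    (e : Set.range f ↪ ι) (c : ι → (Fin r → ZMod 2))
    (hc : ∀ i j, i ≠ j → 2 * t ≤ hammingDist (c i) (c j)) :
    IsFCC t f fun u => c (e (Set.rangeFactorization f u)) := by
  intro u₁ u₂ h
  have hu : 0 < hammingDist u₁ u₂ := hammingDist_pos.mpr fun hu => h (congrArg f hu)
  have hd := hc (e (Set.rangeFactorization f u₁)) (e (Set.rangeFactorization f u₂))
    fun he => h (congrArg Subtype.val (e.injective he))
  dsimp only
  omega

/-- Upper bound via error-correcting codes on function values: for `E = |Im(f)|`,
`r_f(k,t) ≤ N(E, 2t)`. -/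
theorem fcc_upper_bound_ecc_on_values {k t : ℕ} {S : Type*}
    (f : (Fin k → ZMod 2) → S) (E : ℕ) (hE : E = Nat.card (Set.range f)) :
    FCCredundancy f t ≤ NcodeReg E (2 * t) := by
  subst hE
  obtain ⟨c, hc⟩ := NcodeReg_spec (Nat.card (Set.range f)) (2 * t)
  exact Nat.sInf_le ⟨_, isFCC_of_code f (Finite.equivFin (Set.range f)).toEmbedding c hc⟩
end

section
/- Optimal redundancy for binary functions: for any function f : ℤ₂^k → S whose image has exactly 2 elements and any t ∈ ℕ, the optimal redundancy satisfies r_f(k,t) = 2t. -/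
theorem hammingDist_update_self_le {ι : Type*} {β : ι → Type*} [Fintype ι] [DecidableEq ι]
    [∀ i, DecidableEq (β i)] (u : ∀ i, β i) (i : ι) (x : β i) :
    hammingDist u (Function.update u i x) ≤ 1 := by
  refine (Finset.card_le_card (t := {i}) fun j hj => ?_).trans (Finset.card_singleton i).le
  by_contra h
  simp_all [Function.update_of_ne]

/-- A function on a finite product that is not constant changes value across some pair of points
at Hamming distance at most one. -/
theorem exists_hammingDist_le_one_of_ne {ι S : Type*} {β : ι → Type*} [Fintype ι]
    [∀ i, DecidableEq (β i)] (f : (∀ i, β i) → S) {u v : ∀ i, β i} (h : f u ≠ f v) :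
    ∃ x y, hammingDist x y ≤ 1 ∧ f x ≠ f y := by
  classical
  by_contra! H
  have key (s : Finset ι) : f (s.piecewise v u) = f u := by
    induction s using Finset.induction_on with
    | empty => simp
    | insert i s _ ih =>
      rw [Finset.piecewise_insert, ← ih]
      exact (H _ _ (hammingDist_update_self_le _ i _)).symm
  exact h (by simpa using (key Finset.univ).symm)

/-- Repeating a two-valued function `2 * t` times gives a function-correcting code. -/
theorem exists_isFCC_of_range_subset_pair {k : ℕ} {S : Type*} (t : ℕ)
    (f : (Fin k → ZMod 2) → S) {a b : S} (hf : Set.range f ⊆ {a, b}) :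
    ∃ p : (Fin k → ZMod 2) → (Fin (2 * t) → ZMod 2), IsFCC t f p := by
  classical
  refine ⟨fun u _ => if f u = a then 0 else 1, fun u v huv => ?_⟩
  have hpos : 0 < hammingDist u v := hammingDist_pos.2 fun h => huv (congrArg f h)
  have hpar : (if f u = a then (0 : ZMod 2) else 1) ≠ if f v = a then 0 else 1 := by
    have hu : f u = a ∨ f u = b := hf ⟨u, rfl⟩
    have hv : f v = a ∨ f v = b := hf ⟨v, rfl⟩
    split_ifs <;> simp_all
  have hdist : hammingDist (fun _ : Fin (2 * t) => if f u = a then (0 : ZMod 2) else 1)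
      (fun _ => if f v = a then 0 else 1) = 2 * t := by
    simp [hammingDist, hpar]
  dsimp only
  omega

/-- Optimal redundancy for binary functions: if the image of `f` has exactly 2 elements,
then `r_f(k,t) = 2t`. -/
theorem fcc_binary_function {k t : ℕ} {S : Type*}
    (f : (Fin k → ZMod 2) → S) (hE : Nat.card (Set.range f) = 2) :
    FCCredundancy f t = 2 * t := by
  have hcard : (Set.range f).ncard = 2 := hE
  obtain ⟨a, b, hab, hrange⟩ := Set.ncard_eq_two.1 hcard
  obtain ⟨u, rfl⟩ : a ∈ Set.range f := by simp [hrange]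
  obtain ⟨v, rfl⟩ : b ∈ Set.range f := by simp [hrange]
  have hmem := exists_isFCC_of_range_subset_pair t f hrange.subset
  refine le_antisymm (Nat.sInf_le hmem) (le_csInf ⟨_, hmem⟩ ?_)
  rintro r ⟨p, hp⟩
  exact hp.two_mul_le hab
end

section
/- Optimal redundancy for the Hamming weight function: let wt : ℤ₂^k → {0,1,…,k} be the Hamming weight function, and let D_wt(t) be the (k+1)×(k+1) matrix with rows and columns indexed by 0,…,k, zero diagonal, and off-diagonal entries [D_wt(t)]_{ij} = max(2t+1 − |i−j|, 0). Then for all k,t ∈ ℕ, r_wt(k,t) = N(k+1, D_wt(t)). -/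
/-- The distance matrix `D_wt(t)` of the Hamming weight function: zero on the diagonal
and `max(2t+1 − |i−j|, 0)` off the diagonal. -/
def hammingWeightDistMatrix (k t : ℕ) : Matrix (Fin (k + 1)) (Fin (k + 1)) ℕ :=
  fun i j => if i = j then 0
    else ((2 * t + 1 : ℤ) - |(i.val : ℤ) - (j.val : ℤ)|).toNat

/-- The Hamming distance is at least the difference of the Hamming weights. -/
lemma abs_hammingNorm_sub_le_hammingDist {ι : Type*} [Fintype ι] {β : ι → Type*}
    [∀ i, DecidableEq (β i)] [∀ i, Zero (β i)] (x y : ∀ i, β i) :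
    |(hammingNorm x : ℤ) - hammingNorm y| ≤ hammingDist x y := by
  have hxy := hammingDist_triangle x y 0
  have hyx := hammingDist_triangle y x 0
  rw [hammingDist_zero_right, hammingDist_zero_right] at hxy hyx
  rw [hammingDist_comm y x] at hyx
  rw [abs_le]
  omega

/-- The binary vector of length `k` whose first `n` coordinates are ones. -/
def initialOnes (k n : ℕ) : Fin k → ZMod 2 :=
  fun l => if l.val < n then 1 else 0

lemma hammingNorm_initialOnes {k n : ℕ} (hn : n ≤ k) :
    hammingNorm (initialOnes k n) = n := by
  simp [hammingNorm, initialOnes, Fin.card_filter_val_lt, hn]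

lemma hammingDist_initialOnes_le_of_le (k : ℕ) {m n : ℕ} (hmn : m ≤ n) :
    hammingDist (initialOnes k m) (initialOnes k n) ≤ n - m := by
  rw [← Nat.card_Ico]
  refine Finset.card_le_card_of_injOn Fin.val (fun l hl => ?_) Fin.val_injective.injOn
  rw [Finset.mem_coe, Finset.mem_filter] at hl
  rw [Finset.mem_coe, Finset.mem_Ico]
  by_contra hout
  refine hl.2 ?_
  simp only [initialOnes]
  split_ifs <;> first | rfl | omega

lemma hammingDist_initialOnes_le (k m n : ℕ) :
    (hammingDist (initialOnes k m) (initialOnes k n) : ℤ) ≤ |(m : ℤ) - n| := by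
  rcases le_total m n with h | h
  · have := hammingDist_initialOnes_le_of_le k h
    rw [abs_sub_comm, abs_of_nonneg] <;> omega
  · have := hammingDist_initialOnes_le_of_le k h
    rw [hammingDist_comm, abs_of_nonneg] <;> omega

/-- Restricting a function-correcting code for the Hamming weight to one representative
of each weight gives an irregular-distance code. -/
lemma IsFCC.isIrregularCode_hammingWeight {k t r : ℕ}
    {p : (Fin k → ZMod 2) → (Fin r → ZMod 2)}
    (hp : IsFCC t (fun u : Fin k → ZMod 2 => hammingNorm u) p) :
    IsIrregularCode (hammingWeightDistMatrix k t)
      (fun i : Fin (k + 1) => p (initialOnes k i)) := by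
  intro i j
  unfold hammingWeightDistMatrix
  split_ifs with hij
  · exact Nat.zero_le _
  · have hne : hammingNorm (initialOnes k i) ≠ hammingNorm (initialOnes k j) := by
      rw [hammingNorm_initialOnes (Fin.is_le i), hammingNorm_initialOnes (Fin.is_le j)]
      exact fun h => hij (Fin.ext h)
    have hdist := hp _ _ hne
    have hle := hammingDist_initialOnes_le k i j
    dsimp only
    omega

/-- Redundancy vectors depending only on the weight, taken from an irregular-distance code,
give a function-correcting code for the Hamming weight. -/
lemma IsIrregularCode.isFCC_hammingWeight {k t r : ℕ} {q : Fin (k + 1) → (Fin r → ZMod 2)}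
    (hq : IsIrregularCode (hammingWeightDistMatrix k t) q) :
    IsFCC t (fun u : Fin k → ZMod 2 => hammingNorm u)
      (fun u => q (Fin.ofNat (k + 1) (hammingNorm u))) := by
  intro u v huv
  have hval (w : Fin k → ZMod 2) : (Fin.ofNat (k + 1) (hammingNorm w)).val = hammingNorm w := by
    have := hammingNorm_le_card_fintype (x := w)
    rw [Fintype.card_fin] at this
    exact Nat.mod_eq_of_lt (by omega)
  have hdist := hq (Fin.ofNat (k + 1) (hammingNorm u)) (Fin.ofNat (k + 1) (hammingNorm v))
  have hne : Fin.ofNat (k + 1) (hammingNorm u) ≠ Fin.ofNat (k + 1) (hammingNorm v) := by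
    intro h
    exact huv (by simpa only [hval] using congrArg Fin.val h)
  simp only [hammingWeightDistMatrix, if_neg hne, hval] at hdist
  have hle := abs_hammingNorm_sub_le_hammingDist u v
  dsimp only
  omega

/-- Optimal redundancy for the Hamming weight function:
`r_wt(k,t) = N(k+1, D_wt(t))`. -/
theorem fcc_hamming_weight {k t : ℕ} :
    FCCredundancy (fun u : Fin k → ZMod 2 => hammingNorm u) t =
      Ncode (k + 1) (hammingWeightDistMatrix k t) := by
  unfold FCCredundancy Ncode
  congr 1
  ext r
  exact ⟨fun ⟨_, hp⟩ => ⟨_, hp.isIrregularCode_hammingWeight⟩,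
    fun ⟨_, hq⟩ => ⟨_, hq.isFCC_hammingWeight⟩⟩
end

section
/- Exact redundancy of FCCs for the Hamming weight function at few errors: for any k > 2, r_wt(k,1) = 3 and r_wt(k,2) = 6. -/
theorem hammingDist_perimeter_le {r : ℕ} (a b c : Fin r → ZMod 2) :
    hammingDist a b + hammingDist b c + hammingDist a c ≤ 2 * r := by
  have h (x y z : ZMod 2) :
      (if x ≠ y then 1 else 0) + (if y ≠ z then 1 else 0) + (if x ≠ z then 1 else 0) ≤ 2 := by
    revert x y z
    decide
  simp only [hammingDist, Finset.card_filter, ← Finset.sum_add_distrib]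
  calc _ ≤ ∑ _i : Fin r, 2 := Finset.sum_le_sum fun i _ => h (a i) (b i) (c i)
    _ = 2 * r := by simp [mul_comm]

theorem three_mul_le_of_isFCC_hammingNorm {k r t : ℕ} (hk : 2 ≤ k)
    {p : (Fin k → ZMod 2) → (Fin r → ZMod 2)}
    (hp : IsFCC t (fun u : Fin k → ZMod 2 => hammingNorm u) p) : 3 * t ≤ r := by
  let i : Fin k := ⟨0, by omega⟩
  let j : Fin k := ⟨1, by omega⟩
  have hij : i ≠ j := by simp [i, j]
  let e : Fin k → ZMod 2 := Pi.single i 1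
  let e' : Fin k → ZMod 2 := Pi.single i 1 + Pi.single j 1
  have single_norm (l : Fin k) : hammingNorm (Pi.single l 1 : Fin k → ZMod 2) = 1 := by
    rw [hammingNorm, Finset.card_eq_one]
    exact ⟨l, by ext m; simp [Pi.single_apply]⟩
  have he : hammingNorm e = 1 := single_norm i
  have he' : hammingNorm e' = 2 := by
    rw [hammingNorm, Finset.card_eq_two]
    refine ⟨i, j, hij, ?_⟩
    ext m
    simp only [e', Finset.mem_filter, Finset.mem_univ, true_and, Pi.add_apply, Pi.single_apply,
      Finset.mem_insert, Finset.mem_singleton]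
    by_cases hi : m = i <;> by_cases hj : m = j <;> simp_all
  have hee' : hammingDist e e' = 1 := by
    rw [hammingDist_eq_hammingNorm, ← single_norm j]
    congr 1
    simp [e, e']
  have h₁ := hp 0 e (by simp [he])
  have h₂ := hp e e' (by simp [he, he'])
  have h₃ := hp 0 e' (by simp [he'])
  rw [hammingDist_zero_left] at h₁ h₃
  have := hammingDist_perimeter_le (p 0) (p e) (p e')
  omega

theorem isFCC_hammingNorm_of_sequence {k r t : ℕ} (c : ℕ → Fin r → ZMod 2)
    (hc : ∀ n d, 0 < d → d ≤ 2 * t → 2 * t + 1 ≤ d + hammingDist (c n) (c (n + d))) :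
    IsFCC t (fun u : Fin k → ZMod 2 => hammingNorm u) fun u => c (hammingNorm u) := by
  have key (u v : Fin k → ZMod 2) (huv : hammingNorm u < hammingNorm v) :
      2 * t + 1 ≤ hammingDist u v + hammingDist (c (hammingNorm u)) (c (hammingNorm v)) := by
    have htri := hammingDist_triangle 0 u v
    simp only [hammingDist_zero_left] at htri
    obtain ⟨d, hd⟩ := Nat.exists_eq_add_of_lt huv
    by_cases hdt : d + 1 ≤ 2 * t
    · have := hc (hammingNorm u) (d + 1) (by omega) hdt
      rw [← add_assoc, ← hd] at this
      omega
    · omega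
  intro u v huv
  rcases lt_or_gt_of_ne huv with h | h
  · exact key u v h
  · rw [hammingDist_comm u, hammingDist_comm (c _)]
    exact key v u h

theorem FCCredundancy_hammingNorm_eq {k t : ℕ} (hk : 2 ≤ k) (c : ℕ → Fin (3 * t) → ZMod 2)
    (hc : ∀ n d, 0 < d → d ≤ 2 * t → 2 * t + 1 ≤ d + hammingDist (c n) (c (n + d))) :
    FCCredundancy (fun u : Fin k → ZMod 2 => hammingNorm u) t = 3 * t := by
  have hmem := isFCC_hammingNorm_of_sequence (k := k) c hc
  refine IsLeast.csInf_eq ⟨⟨_, hmem⟩, ?_⟩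
  rintro r ⟨p, hp⟩
  exact three_mul_le_of_isFCC_hammingNorm hk hp

/-- Codewords which, repeated periodically, encode the weight tolerating one error. -/
def weightCodeOne : Fin 3 → Fin 3 → ZMod 2 :=
  ![![0, 0, 0], ![1, 1, 0], ![1, 0, 1]]

/-- Codewords which, repeated periodically, encode the weight tolerating two errors. -/
def weightCodeTwo : Fin 6 → Fin 6 → ZMod 2 :=
  ![![0, 0, 0, 0, 0, 0], ![0, 0, 1, 1, 1, 1], ![1, 1, 0, 0, 0, 1],
    ![0, 1, 0, 1, 1, 0], ![1, 0, 1, 0, 1, 0], ![1, 1, 1, 1, 0, 1]]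

theorem Fin.ofNat_add_ofNat_eq (m : ℕ) [NeZero m] (a b : ℕ) :
    Fin.ofNat m a + Fin.ofNat m b = Fin.ofNat m (a + b) := by
  ext
  simp [Fin.val_add]

theorem weightCodeOne_dist (a : Fin 3) (d : Fin 3) (hd : 0 < d.val) :
    3 ≤ d.val + hammingDist (weightCodeOne a) (weightCodeOne (a + Fin.ofNat 3 d.val)) := by
  revert a d
  decide

theorem weightCodeTwo_dist (a : Fin 6) (d : Fin 5) (hd : 0 < d.val) :
    5 ≤ d.val + hammingDist (weightCodeTwo a) (weightCodeTwo (a + Fin.ofNat 6 d.val)) := by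
  revert a d
  decide

/-- Exact redundancy of FCCs for the Hamming weight function at few errors:
for `k > 2`, `r_wt(k,1) = 3` and `r_wt(k,2) = 6`. -/
theorem fcc_hamming_weight_small_t {k : ℕ} (hk : 2 < k) :
    FCCredundancy (fun u : Fin k → ZMod 2 => hammingNorm u) 1 = 3 ∧
    FCCredundancy (fun u : Fin k → ZMod 2 => hammingNorm u) 2 = 6 := by
  constructor
  · refine FCCredundancy_hammingNorm_eq (t := 1) hk.le (fun n => weightCodeOne (Fin.ofNat 3 n)) ?_
    intro n d hd hdt
    have := weightCodeOne_dist (Fin.ofNat 3 n) ⟨d, by omega⟩ hd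
    rwa [Fin.ofNat_add_ofNat_eq] at this
  · refine FCCredundancy_hammingNorm_eq (t := 2) hk.le (fun n => weightCodeTwo (Fin.ofNat 6 n)) ?_
    intro n d hd hdt
    have := weightCodeTwo_dist (Fin.ofNat 6 n) ⟨d, by omega⟩ hd
    rwa [Fin.ofNat_add_ofNat_eq] at this
end
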